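/- arXiv:1306.5779 — 6 statements merged into one kernel-verified Lean document; each statement's English description precedes it below -/
import Mathlib

section
/- Let λ be a 4-net of order n embedded in PG(2,K) with constant cross-ratio κ, and set N = n(n−1). Then κ^N = 1 in K. -/
/-- The point set of the projective plane `PG(2,K)`. -/
abbrev PGPoint (K : Type*) [Field K] := Projectivization K (Fin 3 → K)

/-- The line set of `PG(2,K)`, a line being given by its dual (homogeneous)
coordinates, i.e. by a nonzero linear form up to a scalar. -/
abbrev PGLine (K : Type*) [Field K] := Projectivization K (Fin 3 → K)

/-- Incidence between a point and a line of `PG(2,K)`. -/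
def Incident {K : Type*} [Field K] (P : PGPoint K) (l : PGLine K) : Prop :=
  ∑ i, P.rep i * l.rep i = 0

/-- The cross-ratio of four (distinct, concurrent) lines of `PG(2,K)`, taken in this
order, equals `κ`:  if the first two lines have equations `r = 0` and `w = 0`, and the
other two have equations `σ•r + τ•w = 0` and `δ•r + ω•w = 0`, the cross-ratio is
`(τ/σ)·(δ/ω)`. -/
def CrossRatioLines {K : Type*} [Field K] (l₁ l₂ l₃ l₄ : PGLine K) (κ : K) : Prop :=
  ∃ (r w : Fin 3 → K) (σ τ δ ω : K) (hr : r ≠ 0) (hw : w ≠ 0)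
    (h₃ : σ • r + τ • w ≠ 0) (h₄ : δ • r + ω • w ≠ 0),
    σ ≠ 0 ∧ τ ≠ 0 ∧ δ ≠ 0 ∧ ω ≠ 0 ∧
    l₁ = Projectivization.mk K r hr ∧ l₂ = Projectivization.mk K w hw ∧
    l₃ = Projectivization.mk K (σ • r + τ • w) h₃ ∧
    l₄ = Projectivization.mk K (δ • r + ω • w) h₄ ∧
    κ = (τ / σ) * (δ / ω)

/-- A `k`-net of order `n` embedded in `PG(2,K)`: `k` pairwise disjoint sets of lines
(the components), each of size `n`, such that any two lines from distinct components
meet in a point through which passes exactly one line of each of the `k` components. -/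
structure IsNet (K : Type*) [Field K] (k n : ℕ) (Λ : Fin k → Finset (PGLine K)) : Prop where
  card_eq : ∀ i, (Λ i).card = n
  disj : ∀ i j, i ≠ j → Disjoint (Λ i) (Λ j)
  meets : ∀ i j, i ≠ j → ∀ l₁ ∈ Λ i, ∀ l₂ ∈ Λ j,
    ∃ P : PGPoint K, Incident P l₁ ∧ Incident P l₂ ∧
      ∀ m, ∃! l, l ∈ Λ m ∧ Incident P l

/-- A point of the net: a point lying on two lines from distinct components. -/
def IsNetPoint {K : Type*} [Field K] {k : ℕ} (Λ : Fin k → Finset (PGLine K))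
    (P : PGPoint K) : Prop :=
  ∃ i j, i ≠ j ∧ ∃ l₁ ∈ Λ i, ∃ l₂ ∈ Λ j, Incident P l₁ ∧ Incident P l₂

/-- A 4-net has constant cross-ratio `κ` if for every point `P` of the net, the
cross-ratio of the four lines of the net through `P`, taken in the component order,
equals `κ`. -/
def HasConstantCrossRatio {K : Type*} [Field K] (Λ : Fin 4 → Finset (PGLine K)) (κ : K) : Prop :=
  ∀ P : PGPoint K, IsNetPoint Λ P →
    ∀ l₁ ∈ Λ 0, ∀ l₂ ∈ Λ 1, ∀ l₃ ∈ Λ 2, ∀ l₄ ∈ Λ 3,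
      Incident P l₁ → Incident P l₂ → Incident P l₃ → Incident P l₄ →
        CrossRatioLines l₁ l₂ l₃ l₄ κ

open Finset in
theorem core_pow {K I J : Type*} [Field K] [Fintype I] [Fintype J] [DecidableEq I] [DecidableEq J]
    (n : ℕ) (hI : Fintype.card I = n) (hJ : Fintype.card J = n) (κ : K) (hk : κ ≠ 0)
    (x y : I → J → K) (hxy : ∀ i j, x i j * y i j = κ)
    (h : ∀ i j, (∏ j' ∈ univ.erase j, x i j') * (∏ i' ∈ univ.erase i, y i' j) = 1) :
    κ ^ (n * (n - 1)) = 1 := by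
  have h1 : ∀ i j, (∏ j', x i j') * (∏ i', y i' j) = κ := by
    intro i j
    rw [← mul_prod_erase univ (fun j' => x i j') (mem_univ j),
      ← mul_prod_erase univ (fun i' => y i' j) (mem_univ i), mul_mul_mul_comm, h, hxy, mul_one]
  have e : I ≃ J := Fintype.equivOfCardEq (hI.trans hJ.symm)
  have h2 : ∏ i, ((∏ j', x i j') * (∏ i', y i' (e i))) = κ ^ n := by
    simp [h1, hI]
  rw [prod_mul_distrib, Equiv.prod_comp e (fun j => ∏ i', y i' j), prod_comm (s := univ (α := J)),
    ← prod_mul_distrib] at h2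
  simp only [← prod_mul_distrib, hxy] at h2
  simp only [prod_const, card_univ, hI, hJ, ← pow_mul] at h2
  have h3 : n * n = n * (n - 1) + n := by
    cases n with
    | zero => rfl
    | succ m => simp; ring
  rw [h3, pow_add] at h2
  exact mul_right_cancel₀ (pow_ne_zero n hk) (by rw [h2, one_mul])

open Finset in
theorem prod_inj {K J T : Type*} [Field K] [Fintype J] [Fintype T] [DecidableEq J] [DecidableEq T]
    (hc : Fintype.card J = Fintype.card T) (f : J → T) (hf : Function.Injective f)
    (g : T → K) (j : J) :
    ∏ j' ∈ univ.erase j, g (f j') = ∏ t ∈ univ.erase (f j), g t := by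
  have hb := (Fintype.bijective_iff_injective_and_card f).2 ⟨hf, hc⟩
  refine prod_nbij f ?_ hf.injOn ?_ (fun _ _ => rfl)
  · intro a ha
    simp only [mem_erase, mem_univ, and_true] at ha ⊢
    exact fun h => ha (hf h)
  · intro t ht
    obtain ⟨a, rfl⟩ := hb.2 t
    refine ⟨a, ?_, rfl⟩
    simp at ht ⊢
    exact fun h => ht (by rw [h])

open Finset in
theorem half_id {K I J T : Type*} [Field K] [Fintype I] [Fintype J] [Fintype T]
    [DecidableEq I] [DecidableEq J] [DecidableEq T]
    (hI : Fintype.card I = Fintype.card T) (hJ : Fintype.card J = Fintype.card T)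
    (r : I → Fin 3 → K) (w : J → Fin 3 → K) (t : T → Fin 3 → K) (P : I → J → Fin 3 → K)
    (k : I → J → T) (σ τ : I → J → K) (hσ : ∀ i j, σ i j ≠ 0) (hτ : ∀ i j, τ i j ≠ 0)
    (ht : ∀ i j, t (k i j) = σ i j • r i + τ i j • w j)
    (hr : ∀ i j i', P i j ⬝ᵥ r i' = 0 ↔ i' = i)
    (hw : ∀ i j j', P i j ⬝ᵥ w j' = 0 ↔ j' = j) (i : I) (j : J) :
    (∏ j' ∈ univ.erase j, τ i j') * (∏ j' ∈ univ.erase j, P i j ⬝ᵥ w j') =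
    (∏ i' ∈ univ.erase i, σ i' j) * (∏ i' ∈ univ.erase i, P i j ⬝ᵥ r i') := by
  have e1 : ∀ j j', P i j ⬝ᵥ t (k i j') = τ i j' * (P i j ⬝ᵥ w j') := by
    intro j j'
    rw [ht, dotProduct_add, dotProduct_smul, dotProduct_smul, (hr i j i).2 rfl]
    simp
  have e2 : ∀ i i', P i j ⬝ᵥ t (k i' j) = σ i' j * (P i j ⬝ᵥ r i') := by
    intro i i'
    rw [ht, dotProduct_add, dotProduct_smul, dotProduct_smul, (hw i j j).2 rfl]
    simp
  have i1 : Function.Injective (fun j => k i j) := by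
    intro a b hab
    have h1 := e1 a a
    have h2 := e1 a b
    simp only at hab
    rw [(hw i a a).2 rfl, mul_zero, hab, h2] at h1
    exact ((hw i a b).1 ((mul_eq_zero.1 h1).resolve_left (hτ _ _))).symm
  have i2 : Function.Injective (fun i => k i j) := by
    intro a b hab
    have h1 := e2 a a
    have h2 := e2 a b
    simp only at hab
    rw [(hr a j a).2 rfl, mul_zero, hab, h2] at h1
    exact ((hr a j b).1 ((mul_eq_zero.1 h1).resolve_left (hσ _ _))).symm
  have p1 := prod_inj hJ _ i1 (fun q => P i j ⬝ᵥ t q) j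
  have p2 := prod_inj hI _ i2 (fun q => P i j ⬝ᵥ t q) i
  simp only [e1, e2] at p1 p2
  rw [← prod_mul_distrib, ← prod_mul_distrib, p1, p2]

theorem rep_smul {K : Type*} [Field K] (l : PGLine K) (v : Fin 3 → K) (hv : v ≠ 0)
    (h : l = Projectivization.mk K v hv) : ∃ a : K, a ≠ 0 ∧ v = a • l.rep := by
  subst h
  obtain ⟨a, ha⟩ := Projectivization.exists_smul_eq_mk_rep K v hv
  refine ⟨((a⁻¹ : Kˣ) : K), Units.ne_zero _, ?_⟩
  rw [← ha]
  change v = a⁻¹ • (a • v)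
  simp

theorem cr_rep {K : Type*} [Field K] {l₁ l₂ l₃ l₄ : PGLine K} {κ : K}
    (h : CrossRatioLines l₁ l₂ l₃ l₄ κ) : ∃ σ τ δ ω : K,
      σ ≠ 0 ∧ τ ≠ 0 ∧ δ ≠ 0 ∧ ω ≠ 0 ∧ l₃.rep = σ • l₁.rep + τ • l₂.rep ∧
      l₄.rep = δ • l₁.rep + ω • l₂.rep ∧ (τ / ω) * (δ / σ) = κ := by
  obtain ⟨r, w, σ, τ, δ, ω, hr, hw, h₃, h₄, h5, h6, h7, h8, e1, e2, e3, e4, rfl⟩ := h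
  obtain ⟨a, ha, f1⟩ := rep_smul _ _ _ e1
  obtain ⟨b, hb, f2⟩ := rep_smul _ _ _ e2
  obtain ⟨c, hc, f3⟩ := rep_smul _ _ _ e3
  obtain ⟨d, hd, f4⟩ := rep_smul _ _ _ e4
  refine ⟨c⁻¹ * σ * a, c⁻¹ * τ * b, d⁻¹ * δ * a, d⁻¹ * ω * b, by simp [*], by simp [*],
    by simp [*], by simp [*], ?_, ?_, ?_⟩
  · rw [← inv_smul_smul₀ hc l₃.rep, ← f3, f1, f2]
    simp only [smul_add, smul_smul, mul_assoc]
  · rw [← inv_smul_smul₀ hd l₄.rep, ← f4, f1, f2]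
    simp only [smul_add, smul_smul, mul_assoc]
  · field_simp

/-- If a 4-net of order `n` embedded in `PG(2,K)` has constant cross-ratio `κ`,
then `κ^(n(n-1)) = 1`. -/
theorem cross_ratio_pow_eq_one {K : Type*} [Field K]
    (n : ℕ) (Λ : Fin 4 → Finset (PGLine K)) (h : IsNet K 4 n Λ)
    (κ : K) (hκ : HasConstantCrossRatio Λ κ) :
    κ ^ (n * (n - 1)) = 1 := by
  classical
  rcases Nat.eq_zero_or_pos n with rfl | hn
  · simp
  have hcard : ∀ m, Fintype.card {l // l ∈ Λ m} = n := fun m => by simp [h.card_eq m]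
  have main : ∀ (i : {l // l ∈ Λ 0}) (j : {l // l ∈ Λ 1}),
      ∃ (P : Fin 3 → K) (k : {l // l ∈ Λ 2}) (s : {l // l ∈ Λ 3}) (σ τ δ ω : K),
      (∀ i' : {l // l ∈ Λ 0}, P ⬝ᵥ i'.1.rep = 0 ↔ i' = i) ∧
      (∀ j' : {l // l ∈ Λ 1}, P ⬝ᵥ j'.1.rep = 0 ↔ j' = j) ∧
      σ ≠ 0 ∧ τ ≠ 0 ∧ δ ≠ 0 ∧ ω ≠ 0 ∧ k.1.rep = σ • i.1.rep + τ • j.1.rep ∧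
      s.1.rep = δ • i.1.rep + ω • j.1.rep ∧ (τ / ω) * (δ / σ) = κ := by
    rintro ⟨i, hi⟩ ⟨j, hj⟩
    obtain ⟨P, hPi, hPj, hP⟩ := h.meets 0 1 (by decide) i hi j hj
    obtain ⟨k, ⟨hk, hPk⟩, -⟩ := hP 2
    obtain ⟨s, ⟨hs, hPs⟩, -⟩ := hP 3
    obtain ⟨σ, τ, δ, ω, hh⟩ := cr_rep (hκ P ⟨0, 1, by decide, i, hi, j, hj, hPi, hPj⟩ i hi j hj
      k hk s hs hPi hPj hPk hPs)
    refine ⟨P.rep, ⟨k, hk⟩, ⟨s, hs⟩, σ, τ, δ, ω, ?_, ?_, hh⟩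
    · rintro ⟨i', hi'⟩
      constructor
      · intro h0
        exact Subtype.ext ((hP 0).unique ⟨hi', h0⟩ ⟨hi, hPi⟩)
      · rintro h0
        cases h0
        exact hPi
    · rintro ⟨j', hj'⟩
      constructor
      · intro h0
        exact Subtype.ext ((hP 1).unique ⟨hj', h0⟩ ⟨hj, hPj⟩)
      · rintro h0
        cases h0
        exact hPj
  choose P k s σ τ δ ω hr hw hσ hτ hδ hω hk hs hc using main
  have hκ0 : κ ≠ 0 := by
    obtain ⟨i, hi⟩ := Finset.card_pos.1 ((h.card_eq 0).symm ▸ hn)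
    obtain ⟨j, hj⟩ := Finset.card_pos.1 ((h.card_eq 1).symm ▸ hn)
    rw [← hc ⟨i, hi⟩ ⟨j, hj⟩]
    simp [hσ, hτ, hδ, hω]
  refine core_pow n (hcard 0) (hcard 1) κ hκ0 (fun i j => τ i j / ω i j)
    (fun i j => δ i j / σ i j) hc ?_
  intro i j
  have q1 := half_id ((hcard 0).trans (hcard 2).symm) ((hcard 1).trans (hcard 2).symm)
    (fun l => l.1.rep) (fun l => l.1.rep) (fun l => l.1.rep) P k σ τ hσ hτ hk
    hr hw i j
  have q2 := half_id ((hcard 0).trans (hcard 3).symm) ((hcard 1).trans (hcard 3).symm)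
    (fun l => l.1.rep) (fun l => l.1.rep) (fun l => l.1.rep) P s δ ω hδ hω hs
    hr hw i j
  have n1 : ∏ j' ∈ Finset.univ.erase j, P i j ⬝ᵥ j'.1.rep ≠ 0 :=
    Finset.prod_ne_zero_iff.2 fun j' hj' h0 => (Finset.ne_of_mem_erase hj') ((hw i j j').1 h0)
  have n2 : ∏ i' ∈ Finset.univ.erase i, P i j ⬝ᵥ i'.1.rep ≠ 0 :=
    Finset.prod_ne_zero_iff.2 fun i' hi' h0 => (Finset.ne_of_mem_erase hi') ((hr i j i').1 h0)
  have n3 : ∏ j' ∈ Finset.univ.erase j, ω i j' ≠ 0 :=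
    Finset.prod_ne_zero_iff.2 fun j' _ => hω i j'
  have n4 : ∏ i' ∈ Finset.univ.erase i, σ i' j ≠ 0 :=
    Finset.prod_ne_zero_iff.2 fun i' _ => hσ i' j
  simp only [Finset.prod_div_distrib]
  rw [div_mul_div_comm, div_eq_one_iff_eq (mul_ne_zero n3 n4)]
  refine mul_right_cancel₀ (mul_ne_zero n1 n2) ?_
  linear_combination (∏ i' ∈ Finset.univ.erase i, δ i' j) *
    (∏ i' ∈ Finset.univ.erase i, P i j ⬝ᵥ i'.1.rep) * q1 -
    (∏ i' ∈ Finset.univ.erase i, σ i' j) *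
    (∏ i' ∈ Finset.univ.erase i, P i j ⬝ᵥ i'.1.rep) * q2
end

section
/- Let λ be a 4-net of order n embedded in PG(2,K) with constant cross-ratio κ, and set N = n(n−1). Then (κ − 1)^N = 1 in K. -/
theorem net_core {K L V : Type*} [Field K] [DecidableEq L] (n : ℕ) (A B C D : Finset L)
    (hA : A.card = n) (hB : B.card = n) (hC : C.card = n) (hD : D.card = n)
    (e : L → V → K) (α γ : L → L → L) (s : L → L → K) (p : L → L → V) (q : K)
    (hα : ∀ b ∈ B, ∀ d ∈ D, α b d ∈ A) (hγ : ∀ b ∈ B, ∀ d ∈ D, γ b d ∈ C)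
    (a1 : ∀ b ∈ B, ∀ d ∈ D, ∀ d' ∈ D, α b d = α b d' → d = d')
    (a2 : ∀ d ∈ D, ∀ b ∈ B, ∀ b' ∈ B, α b d = α b' d → b = b')
    (g1 : ∀ b ∈ B, ∀ d ∈ D, ∀ d' ∈ D, γ b d = γ b d' → d = d')
    (g2 : ∀ d ∈ D, ∀ b ∈ B, ∀ b' ∈ B, γ b d = γ b' d → b = b')
    (hs : ∀ b ∈ B, ∀ d ∈ D, s b d ≠ 0)
    (hp : ∀ b ∈ B, ∀ d ∈ D, e b (p b d) = 0 ∧ e d (p b d) = 0)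
    (hpA : ∀ b ∈ B, ∀ d ∈ D, ∀ a ∈ A, a ≠ α b d → e a (p b d) ≠ 0)
    (e1 : ∀ b ∈ B, ∀ d ∈ D, ∀ v, e b v = 0 → e (γ b d) v = s b d * e (α b d) v)
    (e2 : ∀ b ∈ B, ∀ d ∈ D, ∀ v, e d v = 0 → e (γ b d) v = q * s b d * e (α b d) v) :
    q ^ (n * (n - 1)) = 1 := by
  have key : ∀ (X Y : Finset L) (hX : X.card = n) (hY : Y.card = n) (f : L → L)
      (hf : ∀ x ∈ X, f x ∈ Y) (hi : ∀ x ∈ X, ∀ x' ∈ X, f x = f x' → x = x') (x : L) (hx : x ∈ X)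
      (F : L → K), ∏ y ∈ Y.erase (f x), F y = ∏ x' ∈ X.erase x, F (f x') := by
    intro X Y hX hY f hf hi x hx F
    have hi' : Set.InjOn f (X.erase x : Finset L) := by
      intro u hu v hv h
      exact hi u (Finset.mem_of_mem_erase hu) v (Finset.mem_of_mem_erase hv) h
    have : (X.erase x).image f = Y.erase (f x) := by
      apply Finset.eq_of_subset_of_card_le
      · intro y hy
        obtain ⟨u, hu, rfl⟩ := Finset.mem_image.1 hy
        have := Finset.mem_erase.1 hu
        refine Finset.mem_erase.2 ⟨fun h => this.1 (hi _ this.2 _ hx h), hf _ this.2⟩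
      · rw [Finset.card_image_of_injOn hi', Finset.card_erase_of_mem hx,
          Finset.card_erase_of_mem (hf x hx), hX, hY]
    rw [← this, Finset.prod_image hi']
  have main : ∀ b ∈ B, ∀ d ∈ D,
      ∏ d' ∈ D, s b d' = q ^ (n - 1) * ∏ b' ∈ B, s b' d := by
    intro b hb d hd
    have h1 : ∏ c ∈ C.erase (γ b d), e c (p b d)
        = (∏ d' ∈ D.erase d, s b d') * ∏ a ∈ A.erase (α b d), e a (p b d) := by
      rw [key D C hD hC (γ b) (hγ b hb) (g1 b hb) d hd,
        key D A hD hA (α b) (hα b hb) (a1 b hb) d hd, ← Finset.prod_mul_distrib]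
      exact Finset.prod_congr rfl fun d' hd' =>
        e1 b hb d' (Finset.mem_of_mem_erase hd') _ (hp b hb d hd).1
    have h2 : ∏ c ∈ C.erase (γ b d), e c (p b d)
        = (q ^ (n - 1) * ∏ b' ∈ B.erase b, s b' d) * ∏ a ∈ A.erase (α b d), e a (p b d) := by
      rw [key B C hB hC (fun b => γ b d) (fun b hb => hγ b hb d hd) (g2 d hd) b hb,
        key B A hB hA (fun b => α b d) (fun b hb => hα b hb d hd) (a2 d hd) b hb,
        ← hB, ← Finset.card_erase_of_mem hb, ← Finset.prod_const, ← Finset.prod_mul_distrib,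
        ← Finset.prod_mul_distrib]
      exact Finset.prod_congr rfl fun b' hb' =>
        e2 b' (Finset.mem_of_mem_erase hb') d hd _ (hp b hb d hd).2
    have h3 : ∏ a ∈ A.erase (α b d), e a (p b d) ≠ 0 := Finset.prod_ne_zero_iff.2 fun a ha =>
      hpA b hb d hd a (Finset.mem_of_mem_erase ha) (Finset.ne_of_mem_erase ha)
    have h4 := mul_right_cancel₀ h3 (h1.symm.trans h2)
    rw [← Finset.mul_prod_erase D _ hd, ← Finset.mul_prod_erase B _ hb, h4]
    ring
  rcases Nat.eq_zero_or_pos n with rfl | hn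
  · simp
  obtain ⟨b0, hb0⟩ := Finset.card_pos.1 (hB ▸ hn)
  obtain ⟨d0, hd0⟩ := Finset.card_pos.1 (hD ▸ hn)
  have t1 : ∏ b ∈ B, ∏ d ∈ D, s b d = (∏ d ∈ D, s b0 d) ^ n := by
    rw [Finset.prod_congr rfl fun b hb => (main b hb d0 hd0).trans (main b0 hb0 d0 hd0).symm,
      Finset.prod_const, hB]
  have t2 : (∏ d ∈ D, s b0 d) ^ n = (q ^ (n - 1)) ^ n * ∏ d ∈ D, ∏ b ∈ B, s b d := by
    rw [← hD, ← Finset.prod_const, ← Finset.prod_const, ← Finset.prod_mul_distrib, hD]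
    exact Finset.prod_congr rfl fun d hd => main b0 hb0 d hd
  rw [Finset.prod_comm (s := D) (t := B), ← t1] at t2
  have t3 : ∏ b ∈ B, ∏ d ∈ D, s b d ≠ 0 := Finset.prod_ne_zero_iff.2 fun b hb =>
    Finset.prod_ne_zero_iff.2 fun d hd => hs b hb d hd
  rw [mul_comm n, pow_mul]
  exact mul_right_cancel₀ t3 (by rw [one_mul]; exact t2.symm)

theorem incident_iff_orth {K : Type*} [Field K] (P : PGPoint K) (l : PGLine K) :
    Incident P l ↔ Projectivization.orthogonal P l := by
  conv_rhs => rw [← P.mk_rep, ← l.mk_rep]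
  rw [Projectivization.orthogonal_mk]
  rfl

theorem point_unique {K : Type*} [Field K] {P Q : PGPoint K} {l m : PGLine K} (hlm : l ≠ m)
    (h1 : Incident P l) (h2 : Incident P m) (h3 : Incident Q l) (h4 : Incident Q m) : P = Q := by
  classical
  rw [incident_iff_orth] at *
  exact (Configuration.ofField.eq_or_eq_of_orthogonal h1 h3 h2 h4).resolve_right hlm

theorem cr_coeff {K : Type*} [Field K] {l₁ l₂ l₃ l₄ : PGLine K} {κ : K}
    (h : CrossRatioLines l₁ l₂ l₃ l₄ κ) : ∃ s : K, s ≠ 0 ∧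
      (∀ v : Fin 3 → K, v ⬝ᵥ l₂.rep = 0 → v ⬝ᵥ l₃.rep = s * (v ⬝ᵥ l₁.rep)) ∧
      (∀ v : Fin 3 → K, v ⬝ᵥ l₄.rep = 0 → v ⬝ᵥ l₃.rep = (1 - κ) * s * (v ⬝ᵥ l₁.rep)) := by
  obtain ⟨r, w, σ, τ, δ, ω, hr, hw, h₃, h₄, hσ, hτ, hδ, hω, rfl, rfl, rfl, rfl, rfl⟩ := h
  obtain ⟨x1, e1⟩ := Projectivization.exists_smul_eq_mk_rep K r hr
  obtain ⟨x2, e2⟩ := Projectivization.exists_smul_eq_mk_rep K w hw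
  obtain ⟨x3, e3⟩ := Projectivization.exists_smul_eq_mk_rep K _ h₃
  obtain ⟨x4, e4⟩ := Projectivization.exists_smul_eq_mk_rep K _ h₄
  rw [← e1, ← e2, ← e3, ← e4]
  have n1 := x1.ne_zero
  have n2 := x2.ne_zero
  have n3 := x3.ne_zero
  have n4 := x4.ne_zero
  simp only [Units.smul_def, dotProduct_smul, dotProduct_add, smul_eq_mul]
  refine ⟨x3 * σ / x1, by positivity, ?_, ?_⟩
  · intro v hv
    have : v ⬝ᵥ w = 0 := by simpa [n2] using hv
    rw [this]; field_simp; ring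
  · intro v hv
    have : δ * v ⬝ᵥ r + ω * v ⬝ᵥ w = 0 := by simpa [n4] using hv
    have : v ⬝ᵥ w = - (δ / ω) * v ⬝ᵥ r := by
      field_simp; linear_combination this
    rw [this]; field_simp; ring

/-- If a 4-net of order `n` embedded in `PG(2,K)` has constant cross-ratio `κ`,
then `(κ - 1)^(n(n-1)) = 1`. -/
theorem cross_ratio_sub_one_pow_eq_one {K : Type*} [Field K]
    (n : ℕ) (Λ : Fin 4 → Finset (PGLine K)) (h : IsNet K 4 n Λ)
    (κ : K) (hκ : HasConstantCrossRatio Λ κ) :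
    (κ - 1) ^ (n * (n - 1)) = 1 := by
  classical
  have hex : ∀ b ∈ Λ 1, ∀ d ∈ Λ 3, ∃ (P : PGPoint K) (a c : PGLine K) (s : K),
      Incident P b ∧ Incident P d ∧ a ∈ Λ 0 ∧ c ∈ Λ 2 ∧ Incident P a ∧ Incident P c ∧
      (∀ m, ∃! l, l ∈ Λ m ∧ Incident P l) ∧ s ≠ 0 ∧
      (∀ v : Fin 3 → K, v ⬝ᵥ b.rep = 0 → v ⬝ᵥ c.rep = s * (v ⬝ᵥ a.rep)) ∧
      (∀ v : Fin 3 → K, v ⬝ᵥ d.rep = 0 → v ⬝ᵥ c.rep = (1 - κ) * s * (v ⬝ᵥ a.rep)) := by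
    intro b hb d hd
    obtain ⟨P, h1, h2, h3⟩ := h.meets 1 3 (by decide) b hb d hd
    obtain ⟨a, ⟨ha, hPa⟩, -⟩ := h3 0
    obtain ⟨c, ⟨hc, hPc⟩, -⟩ := h3 2
    obtain ⟨s, hs⟩ := cr_coeff (hκ P ⟨1, 3, by decide, b, hb, d, hd, h1, h2⟩
      a ha b hb c hc d hd hPa h1 hPc h2)
    exact ⟨P, a, c, s, h1, h2, ha, hc, hPa, hPc, h3, hs⟩
  rcases Nat.eq_zero_or_pos n with rfl | hn
  · simp
  obtain ⟨l0, -⟩ := Finset.card_pos.1 ((h.card_eq 1).symm ▸ hn)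
  have hex' : ∀ b d : PGLine K, ∃ (P : PGPoint K) (a c : PGLine K) (s : K), b ∈ Λ 1 → d ∈ Λ 3 →
      Incident P b ∧ Incident P d ∧ a ∈ Λ 0 ∧ c ∈ Λ 2 ∧ Incident P a ∧ Incident P c ∧
      (∀ m, ∃! l, l ∈ Λ m ∧ Incident P l) ∧ s ≠ 0 ∧
      (∀ v : Fin 3 → K, v ⬝ᵥ b.rep = 0 → v ⬝ᵥ c.rep = s * (v ⬝ᵥ a.rep)) ∧
      (∀ v : Fin 3 → K, v ⬝ᵥ d.rep = 0 → v ⬝ᵥ c.rep = (1 - κ) * s * (v ⬝ᵥ a.rep)) := by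
    intro b d
    by_cases hb : b ∈ Λ 1
    · by_cases hd : d ∈ Λ 3
      · obtain ⟨P, a, c, s, H⟩ := hex b hb d hd
        exact ⟨P, a, c, s, fun _ _ => H⟩
      · exact ⟨l0, l0, l0, 0, fun _ h => absurd h hd⟩
    · exact ⟨l0, l0, l0, 0, fun h => absurd h hb⟩
  choose P α γ s H using hex'
  have ne : ∀ i j, i ≠ j → ∀ l ∈ Λ i, ∀ m ∈ Λ j, l ≠ m := fun i j hij l hl m hm =>
    Finset.disjoint_left.1 (h.disj i j hij) |> fun H e => H hl (e ▸ hm)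
  have uni : ∀ b ∈ Λ 1, ∀ d ∈ Λ 3, ∀ m, ∀ l ∈ Λ m, ∀ l' ∈ Λ m,
      Incident (P b d) l → Incident (P b d) l' → l = l' := by
    intro b hb d hd m l hl l' hl' h1 h2
    obtain ⟨-, -, -, -, -, -, hu, -⟩ := H b d hb hd
    exact (hu m).unique ⟨hl, h1⟩ ⟨hl', h2⟩
  have main := net_core n (Λ 0) (Λ 1) (Λ 2) (Λ 3) (h.card_eq 0) (h.card_eq 1) (h.card_eq 2)
    (h.card_eq 3) (fun l v => v ⬝ᵥ l.rep) α γ s (fun b d => (P b d).rep) (1 - κ)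
    (fun b hb d hd => (H b d hb hd).2.2.1) (fun b hb d hd => (H b d hb hd).2.2.2.1)
    ?_ ?_ ?_ ?_ (fun b hb d hd => (H b d hb hd).2.2.2.2.2.2.2.1)
    (fun b hb d hd => ⟨(H b d hb hd).1, (H b d hb hd).2.1⟩) ?_
    (fun b hb d hd => (H b d hb hd).2.2.2.2.2.2.2.2.1)
    (fun b hb d hd => (H b d hb hd).2.2.2.2.2.2.2.2.2)
  · have hev : Even (n * (n - 1)) := Nat.even_mul_pred_self n
    rw [← hev.neg_pow, neg_sub]
    exact main
  · intro b hb d hd d' hd' e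
    obtain ⟨p1, p2, pa, pc, p3, p4, -⟩ := H b d hb hd
    obtain ⟨q1, q2, qa, qc, q3, q4, -⟩ := H b d' hb hd'
    have := point_unique (ne 0 1 (by decide) _ pa _ hb) p3 p1 (e ▸ q3) q1
    exact uni b hb d hd 3 d hd d' hd' p2 (this ▸ q2)
  · intro d hd b hb b' hb' e
    obtain ⟨p1, p2, pa, pc, p3, p4, -⟩ := H b d hb hd
    obtain ⟨q1, q2, qa, qc, q3, q4, -⟩ := H b' d hb' hd
    have := point_unique (ne 0 3 (by decide) _ pa _ hd) p3 p2 (e ▸ q3) q2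
    exact uni b hb d hd 1 b hb b' hb' p1 (this ▸ q1)
  · intro b hb d hd d' hd' e
    obtain ⟨p1, p2, pa, pc, p3, p4, -⟩ := H b d hb hd
    obtain ⟨q1, q2, qa, qc, q3, q4, -⟩ := H b d' hb hd'
    have := point_unique (ne 2 1 (by decide) _ pc _ hb) p4 p1 (e ▸ q4) q1
    exact uni b hb d hd 3 d hd d' hd' p2 (this ▸ q2)
  · intro d hd b hb b' hb' e
    obtain ⟨p1, p2, pa, pc, p3, p4, -⟩ := H b d hb hd
    obtain ⟨q1, q2, qa, qc, q3, q4, -⟩ := H b' d hb' hd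
    have := point_unique (ne 2 3 (by decide) _ pc _ hd) p4 p2 (e ▸ q4) q2
    exact uni b hb d hd 1 b hb b' hb' p1 (this ▸ q1)
  · intro b hb d hd a ha hne h0
    obtain ⟨p1, p2, pa, pc, p3, p4, -⟩ := H b d hb hd
    exact hne (uni b hb d hd 0 a ha _ pa h0 p3)
end

section
/- Let λ = (λ_1, …, λ_k), k ≥ 4, be a k-net of order n embedded in PG(2,K) such that all lines of the component λ_1 pass through a common point. Then the components λ_2, …, λ_k are pairwise projectively equivalent: for all 2 ≤ i < j ≤ k there exists a projective collineation of PG(2,K) mapping the set of lines λ_i onto the set of lines λ_j. -/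
/-- The action of an invertible matrix on the lines of `PG(2,K)` (in dual coordinates);
every projective collineation of `PG(2,K)` acts on the set of lines in this way. -/
noncomputable def lineCollineation {K : Type*} [Field K] (B : GL (Fin 3) K) :
    PGLine K → PGLine K :=
  Projectivization.map ((Matrix.GeneralLinearGroup.toLin B).toLinearEquiv.toLinearMap)
    (Matrix.GeneralLinearGroup.toLin B).toLinearEquiv.injective


theorem inc_iff {K : Type*} [Field K] (P : PGPoint K) (l : PGLine K) :
    Incident P l ↔ P.orthogonal l := by
  have h : P.orthogonal l ↔
      (Projectivization.mk K P.rep P.rep_nonzero).orthogonal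
        (Projectivization.mk K l.rep l.rep_nonzero) := by
    rw [Projectivization.mk_rep, Projectivization.mk_rep]
  rw [h]
  exact Iff.rfl

theorem inc_unique {K : Type*} [Field K] {P R : PGPoint K} {l m : PGLine K}
    (h1 : Incident P l) (h2 : Incident R l) (h3 : Incident P m) (h4 : Incident R m) :
    P = R ∨ l = m := by
  rw [inc_iff] at *
  exact Configuration.ofField.eq_or_eq_of_orthogonal h1 h2 h3 h4

theorem inc_mk {K : Type*} [Field K] (P : PGPoint K) (v : Fin 3 → K) (hv : v ≠ 0) :
    Incident P (Projectivization.mk K v hv) ↔ P.rep ⬝ᵥ v = 0 := by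
  rw [inc_iff, ← Projectivization.orthogonal_mk P.rep_nonzero hv, Projectivization.mk_rep]

theorem lineColl_of_equiv {K : Type*} [Field K] (T : (Fin 3 → K) ≃ₗ[K] (Fin 3 → K)) :
    ∃ B : GL (Fin 3) K, ∀ (v : Fin 3 → K) (hv : v ≠ 0),
      lineCollineation B (Projectivization.mk K v hv) =
        Projectivization.mk K (T v) (by simpa using hv) := by
  refine ⟨Matrix.GeneralLinearGroup.toLin.symm (LinearMap.GeneralLinearGroup.ofLinearEquiv T), ?_⟩
  intro v hv
  unfold lineCollineation
  rw [Projectivization.map_mk]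
  congr 1
  simp

/-- the perspectivity given by a line of a third component -/
theorem net_equiv {K : Type*} [Field K] {k n : ℕ} {Λ : Fin k → Finset (PGLine K)}
    (hnet : IsNet K k n Λ) {a i j : Fin k} (hi : a ≠ i) (hj : a ≠ j) {h : PGLine K}
    (hh : h ∈ Λ a) :
    ∃ e : {x // x ∈ Λ i} ≃ {x // x ∈ Λ j}, ∀ c : {x // x ∈ Λ i}, ∃ P : PGPoint K,
      Incident P h ∧ Incident P c.1 ∧ Incident P (e c).1 ∧
      ∀ m, ∃! l, l ∈ Λ m ∧ Incident P l := by
  have H : ∀ c : {x // x ∈ Λ i}, ∃ (d : {x // x ∈ Λ j}) (P : PGPoint K),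
      Incident P h ∧ Incident P c.1 ∧ Incident P d.1 ∧
      ∀ m, ∃! l, l ∈ Λ m ∧ Incident P l := by
    intro c
    obtain ⟨P, h1, h2, h3⟩ := hnet.meets a i hi h hh c.1 c.2
    obtain ⟨d, hd, -⟩ := h3 j
    exact ⟨⟨d, hd.1⟩, P, h1, h2, hd.2, h3⟩
  choose f P h1 h2 h3 h4 using H
  have finj : Function.Injective f := by
    intro c1 c2 hc
    have h5 := h3 c2
    rw [← hc] at h5
    rcases inc_unique (h1 c1) (h1 c2) (h3 c1) h5 with h6 | h6
    · have h7 := h2 c2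
      rw [← h6] at h7
      exact Subtype.ext ((h4 c1 i).unique ⟨c1.2, h2 c1⟩ ⟨c2.2, h7⟩)
    · exact absurd (h6 ▸ (f c1).2) (Finset.disjoint_left.1 (hnet.disj a j hj) hh)
  have fbij : Function.Bijective f := by
    rw [Fintype.bijective_iff_injective_and_card]
    exact ⟨finj, by simp [hnet.card_eq]⟩
  exact ⟨Equiv.ofBijective f fbij, fun c => ⟨P c, h1 c, h2 c, h3 c, h4 c⟩⟩

theorem pencil_trivial {K : Type*} [Field K] (S T : Finset (PGLine K)) (h : S.card = T.card)
    (h1 : S.card ≤ 1) :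
    ∃ B : GL (Fin 3) K, lineCollineation B '' (S : Set (PGLine K)) = (T : Set (PGLine K)) := by
  rcases Nat.le_one_iff_eq_zero_or_eq_one.1 h1 with h0 | h0
  · have hS := Finset.card_eq_zero.1 h0
    have hT := Finset.card_eq_zero.1 (h ▸ h0)
    exact ⟨1, by simp [hS, hT]⟩
  · obtain ⟨x, rfl⟩ := Finset.card_eq_one.1 h0
    obtain ⟨y, rfl⟩ := Finset.card_eq_one.1 (h ▸ h0)
    have : MulAction.IsPretransitive ((Fin 3 → K) ≃ₗ[K] (Fin 3 → K)) (PGLine K) :=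
      MulAction.isPretransitive_of_is_two_pretransitive
    obtain ⟨g, hg⟩ := MulAction.exists_smul_eq ((Fin 3 → K) ≃ₗ[K] (Fin 3 → K)) x y
    obtain ⟨B, hB⟩ := lineColl_of_equiv g
    refine ⟨B, ?_⟩
    rw [← x.mk_rep] at hg
    have := hB x.rep x.rep_nonzero
    rw [Projectivization.mk_rep] at this
    simp only [Finset.coe_singleton, Set.image_singleton, this]
    rw [← hg]
    rfl

/-- the homology -/
theorem exists_homology {K : Type*} [Field K] (q w : Fin 3 → K) (hqw : q ⬝ᵥ w = 1) (κ : K)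
    (hκ : κ ≠ 0) : ∃ T : (Fin 3 → K) ≃ₗ[K] (Fin 3 → K),
      ∀ x, T x = (q ⬝ᵥ x) • w + κ • (x - (q ⬝ᵥ x) • w) := by
  refine ⟨{ toFun := fun x => (q ⬝ᵥ x) • w + κ • (x - (q ⬝ᵥ x) • w)
            invFun := fun x => (q ⬝ᵥ x) • w + κ⁻¹ • (x - (q ⬝ᵥ x) • w)
            map_add' := ?_
            map_smul' := ?_
            left_inv := ?_
            right_inv := ?_ }, fun x => rfl⟩
  · intro x y
    simp only [dotProduct_add]
    module
  · intro c x
    simp only [dotProduct_smul, smul_eq_mul, RingHom.id_apply]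
    module
  · intro x
    simp only [dotProduct_add, dotProduct_sub, dotProduct_smul, smul_eq_mul, hqw]
    ext t
    simp
    field_simp
    ring
  · intro x
    simp only [dotProduct_add, dotProduct_sub, dotProduct_smul, smul_eq_mul, hqw]
    ext t
    simp
    field_simp
    ring

theorem pencil_main {K : Type*} [Field K]
    (k n : ℕ) (Λ : Fin k → Finset (PGLine K)) (hnet : IsNet K k n Λ)
    (Q : PGPoint K) (o i j m : Fin k) (hQ : ∀ l ∈ Λ o, Incident Q l)
    (hi : o ≠ i) (hj : o ≠ j) (hm : o ≠ m) (hmi : m ≠ i) (hmj : m ≠ j)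
    (hN : ∀ a, o ≠ a → ∀ l ∈ Λ a, ¬ Incident Q l) (ℓ : PGLine K) (hℓ : ℓ ∈ Λ m) :
    ∃ B : GL (Fin 3) K, lineCollineation B '' (Λ i : Set (PGLine K)) = (Λ j : Set (PGLine K)) := by
  classical
  let q := Q.rep
  let V : PGLine K → (Fin 3 → K) := fun l => (q ⬝ᵥ l.rep)⁻¹ • l.rep
  have hVq : ∀ a, o ≠ a → ∀ l ∈ Λ a, q ⬝ᵥ V l = 1 := by
    intro a ha l hl
    have : q ⬝ᵥ l.rep ≠ 0 := hN a ha l hl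
    simp [V, this]
  have hV0 : ∀ a, o ≠ a → ∀ l ∈ Λ a, V l ≠ 0 := by
    intro a ha l hl h0
    have := hVq a ha l hl
    simp [h0] at this
  have hVmk : ∀ a (ha : o ≠ a) l (hl : l ∈ Λ a),
      Projectivization.mk K (V l) (hV0 a ha l hl) = l := by
    intro a ha l hl
    conv_rhs => rw [← l.mk_rep]
    rw [Projectivization.mk_eq_mk_iff']
    exact ⟨_, rfl⟩
  have hVinc : ∀ a, o ≠ a → ∀ l ∈ Λ a, ∀ P, Incident P l ↔ P.rep ⬝ᵥ V l = 0 := by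
    intro a ha l hl P
    rw [← inc_mk P (V l) (hV0 a ha l hl), hVmk a ha l hl]
  have hVinj : ∀ a, o ≠ a → ∀ b, o ≠ b → ∀ l ∈ Λ a, ∀ l' ∈ Λ b, V l = V l' → l = l' := by
    intro a ha b hb l hl l' hl' h
    rw [← hVmk a ha l hl, ← hVmk b hb l' hl']
    congr 1
  -- key linear fact: V l - V l' vanishes on the line QP
  have key : ∀ a, o ≠ a → ∀ b, o ≠ b → ∀ l ∈ Λ a, ∀ l' ∈ Λ b, ∀ P : PGPoint K,
      Incident P l → Incident P l' → ∀ h : PGLine K, Incident Q h → Incident P h →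
      ∃ c : K, V l' - V l = c • h.rep := by
    intro a ha b hb l hl l' hl' P h1 h2 h h3 h4
    by_cases hd : V l' - V l = 0
    · exact ⟨0, by simp [hd]⟩
    have h5 : Incident Q (Projectivization.mk K _ hd) := by
      rw [inc_mk, dotProduct_sub]
      change q ⬝ᵥ V l' - q ⬝ᵥ V l = 0
      rw [hVq a ha l hl, hVq b hb l' hl', sub_self]
    have h6 : Incident P (Projectivization.mk K _ hd) := by
      rw [inc_mk, dotProduct_sub, (hVinc a ha l hl P).1 h1, (hVinc b hb l' hl' P).1 h2, sub_self]
    rcases inc_unique h5 h6 h3 h4 with h7 | h7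
    · subst h7
      exact absurd h1 (hN a ha l hl)
    · rw [← h.mk_rep, Projectivization.mk_eq_mk_iff'] at h7
      obtain ⟨c, hc⟩ := h7
      exact ⟨c, hc.symm⟩
  obtain ⟨π, hπ⟩ := net_equiv hnet hmi hmj hℓ
  choose P hP1 hP2 hP3 hP4 using hπ
  have hh : ∀ s, ∃ h, h ∈ Λ o ∧ Incident (P s) h := fun s => (hP4 s o).exists
  choose h hh1 hh2 using hh
  let w := V ℓ
  have hPw : ∀ s, (P s).rep ⬝ᵥ w = 0 := fun s => (hVinc m hm ℓ hℓ (P s)).1 (hP1 s)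
  let d : {x // x ∈ Λ i} → (Fin 3 → K) := fun c => V c.1 - w
  let d' : {x // x ∈ Λ j} → (Fin 3 → K) := fun c => V c.1 - w
  have hd0 : ∀ c, d c ≠ 0 := by
    intro c hc
    have := hVinj i hi m hm c.1 c.2 ℓ hℓ (sub_eq_zero.1 hc)
    exact Finset.disjoint_left.1 (hnet.disj i m hmi.symm) c.2 (this ▸ hℓ)
  have hd0' : ∀ c, d' c ≠ 0 := by
    intro c hc
    have := hVinj j hj m hm c.1 c.2 ℓ hℓ (sub_eq_zero.1 hc)
    exact Finset.disjoint_left.1 (hnet.disj j m hmj.symm) c.2 (this ▸ hℓ)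
  have hρ : ∀ c, ∃ ρ : K, ρ ≠ 0 ∧ d' (π c) = ρ • d c := by
    intro c
    obtain ⟨x, hx⟩ := key m hm i hi ℓ hℓ c.1 c.2 (P c) (hP1 c) (hP2 c) (h c)
      (hQ _ (hh1 c)) (hh2 c)
    obtain ⟨y, hy⟩ := key m hm j hj ℓ hℓ (π c).1 (π c).2 (P c) (hP1 c) (hP3 c) (h c)
      (hQ _ (hh1 c)) (hh2 c)
    have hx' : d c = x • (h c).rep := hx
    have hy' : d' (π c) = y • (h c).rep := hy
    have hx0 : x ≠ 0 := by
      rintro rfl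
      exact hd0 c (by simpa using hx')
    have hy0 : y ≠ 0 := by
      rintro rfl
      exact hd0' (π c) (by simpa using hy')
    refine ⟨y / x, div_ne_zero hy0 hx0, ?_⟩
    rw [hy', hx', smul_smul, div_mul_cancel₀ _ hx0]
  choose ρ hρ0 hρ using hρ
  have hdP : ∀ s c, (P s).rep ⬝ᵥ d c = (P s).rep ⬝ᵥ V c.1 := by
    intro s c
    simp [d, dotProduct_sub, hPw]
  have hdP' : ∀ s c, (P s).rep ⬝ᵥ d' c = (P s).rep ⬝ᵥ V c.1 := by
    intro s c
    simp [d', dotProduct_sub, hPw]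
  have hne : ∀ s c, c ≠ s → (P s).rep ⬝ᵥ d c ≠ 0 := by
    intro s c hcs h0
    rw [hdP, ← hVinc i hi c.1 c.2] at h0
    exact hcs (Subtype.ext ((hP4 s i).unique ⟨c.2, h0⟩ ⟨s.2, hP2 s⟩))
  have hprod : ∀ s, ∏ c ∈ Finset.univ.erase s, ρ c = 1 := by
    intro s
    obtain ⟨σ, hσ⟩ := net_equiv hnet hi hj (hh1 s)
    have hval : ∀ c, (P s).rep ⬝ᵥ d c = (P s).rep ⬝ᵥ d' (σ c) := by
      intro c
      obtain ⟨R, hR1, hR2, hR3, hR4⟩ := hσ c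
      obtain ⟨x, hx⟩ := key i hi j hj c.1 c.2 (σ c).1 (σ c).2 R hR2 hR3 (h s)
        (hQ _ (hh1 s)) hR1
      rw [hdP, hdP', eq_comm, ← sub_eq_zero, ← dotProduct_sub, hx, dotProduct_smul]
      have : (P s).rep ⬝ᵥ (h s).rep = 0 := hh2 s
      rw [this, smul_zero]
    have hss : σ s = π s := by
      have h0 : (P s).rep ⬝ᵥ d' (σ s) = 0 := by
        rw [← hval, hdP, ← hVinc i hi s.1 s.2]
        exact hP2 s
      rw [hdP', ← hVinc j hj _ (σ s).2] at h0
      exact Subtype.ext ((hP4 s j).unique ⟨(σ s).2, h0⟩ ⟨(π s).2, hP3 s⟩)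
    have e1 : ∏ c ∈ Finset.univ.erase s, (P s).rep ⬝ᵥ d c
        = ∏ c ∈ Finset.univ.erase (σ s), (P s).rep ⬝ᵥ d' c := by
      refine Finset.prod_bij (fun c _ => σ c) ?_ ?_ ?_ ?_
      · intro c hc
        simpa using hc
      · intro a _ b _ hab
        exact σ.injective hab
      · intro b hb
        refine ⟨σ.symm b, ?_, by simp⟩
        simpa [Equiv.symm_apply_eq] using hb
      · intro c _
        exact hval c
    have e2 : ∏ c ∈ Finset.univ.erase s, (ρ c * ((P s).rep ⬝ᵥ d c))
        = ∏ c ∈ Finset.univ.erase (π s), (P s).rep ⬝ᵥ d' c := by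
      refine Finset.prod_bij (fun c _ => π c) ?_ ?_ ?_ ?_
      · intro c hc
        simpa using hc
      · intro a _ b _ hab
        exact π.injective hab
      · intro b hb
        refine ⟨π.symm b, ?_, by simp⟩
        simpa [Equiv.symm_apply_eq] using hb
      · intro c _
        rw [hρ, dotProduct_smul, smul_eq_mul]
    rw [← hss, ← e1, Finset.prod_mul_distrib] at e2
    refine mul_right_cancel₀ (Finset.prod_ne_zero_iff.2 fun c hc => ?_) (e2.trans (one_mul _).symm)
    exact hne s c (Finset.ne_of_mem_erase hc)
  let κ := ∏ c, ρ c
  have hκ : ∀ s, ρ s = κ := by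
    intro s
    have := Finset.mul_prod_erase Finset.univ ρ (Finset.mem_univ s)
    rw [hprod, mul_one] at this
    exact this
  have hκ0 : κ ≠ 0 := Finset.prod_ne_zero_iff.2 fun c _ => hρ0 c
  obtain ⟨T, hT⟩ := exists_homology q w (hVq m hm ℓ hℓ) κ hκ0
  obtain ⟨B, hB⟩ := lineColl_of_equiv T
  have hBc : ∀ c : {x // x ∈ Λ i}, lineCollineation B c.1 = (π c).1 := by
    intro c
    rw [← hVmk i hi c.1 c.2, hB, ← hVmk j hj (π c).1 (π c).2]
    congr 1
    rw [hT, hVq i hi c.1 c.2, one_smul, ← hκ c]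
    have := hρ c
    change V (π c).1 - w = ρ c • (V c.1 - w) at this
    rw [← this]
    abel
  refine ⟨B, ?_⟩
  ext y
  constructor
  · rintro ⟨x, hx, rfl⟩
    rw [hBc ⟨x, hx⟩]
    exact (π ⟨x, hx⟩).2
  · intro hy
    refine ⟨(π.symm ⟨y, hy⟩).1, (π.symm ⟨y, hy⟩).2, ?_⟩
    rw [hBc]
    simp

/-- Let `λ` be a `k`-net (`k ≥ 4`) of order `n` embedded in `PG(2,K)` whose first
component is contained in a line pencil. Then the remaining components are pairwise
projectively equivalent: some projective collineation maps `λ_i` onto `λ_j`. -/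
theorem pencil_component_projective_equivalence {K : Type*} [Field K]
    (k n : ℕ) (hk : 4 ≤ k) (Λ : Fin k → Finset (PGLine K)) (hnet : IsNet K k n Λ)
    (Q : PGPoint K) (hQ : ∀ l ∈ Λ ⟨0, by omega⟩, Incident Q l)
    (i j : Fin k) (hi : i ≠ ⟨0, by omega⟩) (hj : j ≠ ⟨0, by omega⟩) :
    ∃ B : GL (Fin 3) K, lineCollineation B '' (Λ i : Set (PGLine K)) = (Λ j : Set (PGLine K)) := by
  by_cases hn : n ≤ 1
  · exact pencil_trivial _ _ (by rw [hnet.card_eq, hnet.card_eq]) (by rw [hnet.card_eq]; exact hn)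
  have hN : ∀ a, (⟨0, by omega⟩ : Fin k) ≠ a → ∀ l ∈ Λ a, ¬ Incident Q l := by
    intro a ha l hl hQl
    apply hn
    rw [← hnet.card_eq ⟨0, by omega⟩, Finset.card_le_one]
    have hP : ∀ x ∈ Λ ⟨0, by omega⟩, ∀ m, ∃! l, l ∈ Λ m ∧ Incident Q l := by
      intro x hx
      obtain ⟨P, h1, h2, h3⟩ := hnet.meets _ a ha x hx l hl
      rcases inc_unique h1 (hQ x hx) h2 hQl with h | h
      · exact h ▸ h3
      · exact absurd (h ▸ hl) (Finset.disjoint_left.1 (hnet.disj _ a ha) hx)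
    intro x hx y hy
    exact (hP x hx _).unique ⟨hx, hQ x hx⟩ ⟨hy, hQ y hy⟩
  have hk0 : 0 < k := by omega
  obtain ⟨m, hm⟩ : ∃ m : Fin k, m ∉ ({⟨0, hk0⟩, i, j} : Finset (Fin k)) := by
    by_contra hcc
    have hc : ∀ m : Fin k, m ∈ ({⟨0, hk0⟩, i, j} : Finset (Fin k)) :=
      fun m => by_contra fun hm => hcc ⟨m, hm⟩
    have h1 := Finset.card_le_three (a := (⟨0, hk0⟩ : Fin k)) (b := i) (c := j)
    rw [Finset.eq_univ_iff_forall.2 hc, Finset.card_univ, Fintype.card_fin] at h1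
    omega
  simp only [Finset.mem_insert, Finset.mem_singleton, not_or] at hm
  obtain ⟨ℓ, hℓ⟩ : (Λ m).Nonempty := by
    rw [← Finset.card_pos, hnet.card_eq]
    omega
  exact pencil_main k n Λ hnet Q _ i j m hQ hi.symm hj.symm (Ne.symm hm.1) hm.2.1 hm.2.2 hN ℓ hℓ
end

section
/- Let N ≥ 2 be an even integer and consider the polynomials f(X) = (X^N − 1)/(X − 1) and g(X) = ((X − 1)^N − 1)/X in ℤ[X]. Then the greatest common divisor of f and g in ℚ[X] is X² − X + 1 if 6 divides N, and is 1 if 6 does not divide N. -/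
open Polynomial

theorem aux_root (N : ℕ) (hN : N ≠ 0) (z : ℂ) (h1 : z ^ N = 1) (h2 : (z - 1) ^ N = 1) :
    z ^ 2 - z + 1 = 0 := by
  have a1 := Complex.norm_eq_one_of_pow_eq_one h1 hN
  have a2 := Complex.norm_eq_one_of_pow_eq_one h2 hN
  have b1 : Complex.normSq z = 1 := by rw [Complex.normSq_eq_norm_sq, a1]; norm_num
  have b2 : Complex.normSq (z - 1) = 1 := by rw [Complex.normSq_eq_norm_sq, a2]; norm_num
  rw [Complex.normSq_apply] at b1 b2
  simp only [Complex.sub_re, Complex.sub_im, Complex.one_re, Complex.one_im] at b2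
  have hx : z.re = 1 / 2 := by linarith
  apply Complex.ext
  · simp [pow_two]
    nlinarith
  · simp [pow_two]
    rw [hx]; ring

theorem aux_six (N : ℕ) (hE : Even N) (z : ℂ) (h1 : z ^ N = 1) (h : z ^ 2 - z + 1 = 0) :
    6 ∣ N := by
  have h6 : z ^ 6 = 1 := by linear_combination (z ^ 4 + z ^ 3 - z - 1) * h
  have hm : z ^ (N % 6) = 1 := by
    rw [← Nat.div_add_mod N 6, pow_add, pow_mul, h6, one_pow, one_mul] at h1
    exact h1
  obtain ⟨k, hk⟩ := hE
  have : N % 6 = 0 ∨ N % 6 = 2 ∨ N % 6 = 4 := by omega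
  rcases this with h0 | h0 | h0
  · exact Nat.dvd_of_mod_eq_zero h0
  · rw [h0] at hm
    have hz : z = 2 := by linear_combination hm - h
    rw [hz] at h; norm_num at h
  · rw [h0] at hm
    have hz : z = -1 := by linear_combination (z ^ 2 + z) * h - hm
    rw [hz] at h; norm_num at h

/-- Let `N ≥ 2` be even and let `f = (X^N - 1)/(X - 1)` and `g = ((X-1)^N - 1)/X`
in `ℤ[X]`. Then the (monic) greatest common divisor of `f` and `g` in `ℚ[X]` is
`X² - X + 1` if `6 ∣ N`, and `1` otherwise. -/
theorem gcd_of_net_polynomials (N : ℕ) (hN : 2 ≤ N) (hNeven : Even N)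
    (f g : ℤ[X])
    (hf : f * (X - 1) = X ^ N - 1)
    (hg : g * X = (X - 1) ^ N - 1) :
    gcd (f.map (Int.castRingHom ℚ)) (g.map (Int.castRingHom ℚ)) =
      if 6 ∣ N then X ^ 2 - X + 1 else 1 := by
  have hF := congrArg (Polynomial.map (Int.castRingHom ℚ)) hf
  have hG := congrArg (Polynomial.map (Int.castRingHom ℚ)) hg
  simp only [Polynomial.map_mul, Polynomial.map_sub, Polynomial.map_pow, Polynomial.map_X,
    Polynomial.map_one] at hF hG
  generalize f.map (Int.castRingHom ℚ) = F at *
  generalize g.map (Int.castRingHom ℚ) = G at *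
  have hN0 : N ≠ 0 := by omega
  have key1 : ∀ A B : ℚ[X], IsCoprime A B → gcd A B = 1 := by
    intro A B h
    rw [← normalize_gcd A B]
    exact normalize_eq_one.2 ((gcd_isUnit_iff A B).2 h)
  have rF : ∀ z : ℂ, aeval z F = 0 → z ^ N = 1 := by
    intro z hz
    have := congrArg (aeval z) hF
    simp [hz] at this
    linear_combination -this
  have rG : ∀ z : ℂ, aeval z G = 0 → (z - 1) ^ N = 1 := by
    intro z hz
    have := congrArg (aeval z) hG
    simp [hz] at this
    linear_combination -this
  split_ifs with h6
  · obtain ⟨k, hk⟩ := h6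
    have d1 : (X ^ 2 - X + 1 : ℚ[X]) ∣ F := by
      have hc : IsCoprime (X ^ 2 - X + 1 : ℚ[X]) (X - 1) := ⟨1, -X, by ring⟩
      apply hc.dvd_of_dvd_mul_right
      rw [hF, hk, pow_mul]
      exact Dvd.dvd.trans ⟨X ^ 4 + X ^ 3 - X - 1, by ring⟩ (sub_one_dvd_pow_sub_one _ k)
    have d2 : (X ^ 2 - X + 1 : ℚ[X]) ∣ G := by
      have hc : IsCoprime (X ^ 2 - X + 1 : ℚ[X]) X := ⟨1, 1 - X, by ring⟩
      apply hc.dvd_of_dvd_mul_right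
      rw [hG, hk, pow_mul]
      refine Dvd.dvd.trans ⟨(X - 2) * X * (X ^ 2 - 3 * X + 3), by ring⟩
        (sub_one_dvd_pow_sub_one _ k)
    obtain ⟨F', rfl⟩ := d1
    obtain ⟨G', rfl⟩ := d2
    have hmon : (X ^ 2 - X + 1 : ℚ[X]).Monic := by monicity!
    rw [gcd_mul_left, hmon.normalize_eq_self, key1, mul_one]
    rw [isCoprime_iff_aeval_ne_zero_of_isAlgClosed ℚ ℂ]
    intro z
    by_contra! hcon
    obtain ⟨c1, c2⟩ := hcon
    have e1 := rF z (by simp [c1])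
    have e2 := rG z (by simp [c2])
    have e3 := aux_root N hN0 z e1 e2
    have hd := congrArg (fun q => aeval z (derivative q)) hF
    simp [c1, e3] at hd
    have hz : z ≠ 0 := by rintro rfl; simp at e3
    rw [derivative_X_pow] at hd
    simp [hz, hN0] at hd
  · apply key1
    rw [isCoprime_iff_aeval_ne_zero_of_isAlgClosed ℚ ℂ]
    intro z
    by_contra! hcon
    obtain ⟨c1, c2⟩ := hcon
    exact h6 (aux_six N hNeven z (rF z c1) (aux_root N hN0 z (rF z c1) (rG z c2)))
end

section
/- Let N ≥ 2 be an even integer, K a field of characteristic p > 3^{φ(N)}, where φ is Euler's totient function, and κ ∈ K an element satisfying κ^N = 1 and (κ − 1)^N = 1. Then κ² − κ + 1 = 0. -/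
open Polynomial in
lemma rus_key {R : Type*} [CommRing R] [IsDomain R] {N : ℕ} (hN : 0 < N) {ζ : R}
    (h : IsPrimitiveRoot ζ N) (f : ℤ[X]) :
    ((resultant (cyclotomic N ℤ) f (Nat.totient N) f.natDegree : ℤ) : R) =
      ∏ z ∈ primitiveRoots N R, aeval z f := by
  have h0 : ((resultant (cyclotomic N ℤ) f (Nat.totient N) f.natDegree : ℤ) : R) =
      resultant (cyclotomic N R) (f.map (Int.castRingHom R)) (Nat.totient N) f.natDegree := by
    rw [← map_cyclotomic_int N R, resultant_map_map]; rfl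
  have h1 := cyclotomic_eq_prod_X_sub_primitiveRoots h
  have h2 := resultant_prod_left (primitiveRoots N R) (fun z => X - C z)
    (f.map (Int.castRingHom R)) f.natDegree (by simp) natDegree_map_le
  rw [← h1, natDegree_cyclotomic] at h2
  rw [h0, h2]
  refine Finset.prod_congr rfl fun z _ => ?_
  have h3 := resultant_X_sub_C_pow_left z (f.map (Int.castRingHom R)) 1 f.natDegree
    natDegree_map_le
  rw [pow_one (X - C z), pow_one] at h3
  rw [natDegree_X_sub_C, h3, eval_map, aeval_def]
  rfl

lemma rus_complex (x : ℂ) (h1 : ‖x‖ = 1) (h2 : ‖x - 1‖ = 1) : x ^ 2 - x + 1 = 0 := by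
  have e1 : x.re * x.re + x.im * x.im = 1 := by
    rw [← Complex.normSq_apply, Complex.normSq_eq_norm_sq, h1]; norm_num
  have e2 : (x.re - 1) * (x.re - 1) + x.im * x.im = 1 := by
    have : (x - 1).re * (x - 1).re + (x - 1).im * (x - 1).im = 1 := by
      rw [← Complex.normSq_apply, Complex.normSq_eq_norm_sq, h2]; norm_num
    simpa using this
  have e3 : x.re = 1 / 2 := by linarith
  rw [e3] at e1
  apply Complex.ext
  · simp [pow_two, e3]; linarith
  · simp [pow_two, e3]; ring

open Polynomial in
/-- Let `N ≥ 2` be even, `K` a field of characteristic `p > 3^φ(N)`, and `κ ∈ K` with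
`κ^N = 1` and `(κ-1)^N = 1`. Then `κ² - κ + 1 = 0`. -/
theorem root_of_unity_shift_char_p {K : Type*} [Field K] (p : ℕ) [CharP K p]
    (N : ℕ) (hN : 2 ≤ N) (hNeven : Even N)
    (hp : 3 ^ Nat.totient N < p)
    (κ : K) (h1 : κ ^ N = 1) (h2 : (κ - 1) ^ N = 1) :
    κ ^ 2 - κ + 1 = 0 := by
  have hN0 : 0 < N := by omega
  have hpp : p.Prime := (CharP.char_is_prime_or_zero K p).resolve_right (Nat.zero_lt_of_lt hp).ne'
  have hNK : NeZero (N : K) := ⟨fun h => by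
    rw [CharP.cast_eq_zero_iff K p] at h
    have h3 := Nat.le_of_dvd (Nat.totient_pos.2 hN0) (Nat.totient_dvd_of_dvd h)
    rw [Nat.totient_prime hpp] at h3
    have h4 : N.totient < 3 ^ N.totient := Nat.lt_pow_self (by norm_num)
    omega⟩
  let L := AlgebraicClosure K
  obtain ⟨ζ, hζ⟩ := HasEnoughRootsOfUnity.exists_primitiveRoot L N
  have hNe : NeZero N := ⟨by omega⟩
  have hCL : CharP L p := charP_of_injective_algebraMap (algebraMap K L).injective p
  obtain ⟨a, -, ha⟩ := hζ.eq_pow_of_pow_eq_one (ξ := algebraMap K L κ) (by rw [← map_pow, h1, map_one])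
  obtain ⟨b, -, hb⟩ := hζ.eq_pow_of_pow_eq_one (ξ := algebraMap K L (κ - 1)) (by rw [← map_pow, h2, map_one])
  let f : ℤ[X] := X ^ a - X ^ b - 1
  have hfL : aeval ζ f = 0 := by
    simp [f, ha, hb]
  have hr := rus_key hN0 hζ f
  rw [Finset.prod_eq_zero ((mem_primitiveRoots hN0).2 hζ) hfL,
    CharP.intCast_eq_zero_iff L p] at hr
  have hz := Complex.isPrimitiveRoot_exp N (by omega)
  have hc := rus_key hN0 hz f
  have hnorm : ∀ z ∈ primitiveRoots N ℂ, ‖z‖ = 1 := fun z hz =>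
    ((mem_primitiveRoots hN0).1 hz).norm'_eq_one (by omega)
  have hbd : ‖∏ z ∈ primitiveRoots N ℂ, aeval z f‖ ≤ 3 ^ N.totient := by
    rw [norm_prod, ← hz.card_primitiveRoots, ← Finset.prod_const]
    refine Finset.prod_le_prod (fun z _ => norm_nonneg _) fun z hz => ?_
    simp only [f, map_sub, map_pow, aeval_X, map_one]
    have t1 := norm_sub_le (z ^ a - z ^ b) 1
    have t2 := norm_sub_le (z ^ a) (z ^ b)
    simp only [norm_pow, hnorm z hz, one_pow, norm_one] at t1 t2
    linarith
  have hr0 := Int.eq_zero_of_abs_lt_dvd hr (by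
    rw [← hc, Complex.norm_intCast] at hbd
    have : |resultant (cyclotomic N ℤ) f (Nat.totient N) f.natDegree| ≤ 3 ^ N.totient := by
      exact_mod_cast hbd
    refine this.trans_lt ?_
    exact_mod_cast hp)
  rw [hr0, Int.cast_zero, eq_comm, Finset.prod_eq_zero_iff] at hc
  obtain ⟨z, hzm, hzf⟩ := hc
  have hz1 := hnorm z hzm
  have hzp := (mem_primitiveRoots hN0).1 hzm
  simp only [f, map_sub, map_pow, aeval_X, map_one] at hzf
  have hx := rus_complex (z ^ a) (by simp [hz1]) (by
    rw [show z ^ a - 1 = z ^ b by linear_combination hzf]; simp [hz1])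
  let g : ℤ[X] := (X ^ a) ^ 2 - X ^ a + 1
  have hg : aeval z g = 0 := by simpa [g] using hx
  have hd := minpoly.isIntegrallyClosed_dvd (hzp.isIntegral hN0) hg
  rw [← cyclotomic_eq_minpoly hzp hN0] at hd
  obtain ⟨q, hq⟩ := hd
  have hcy : aeval ζ (cyclotomic N ℤ) = 0 := by
    have := hζ.isRoot_cyclotomic hN0
    rw [IsRoot.def, ← map_cyclotomic_int N L, eval_map] at this
    rw [aeval_def]; exact this
  have hgL : aeval ζ g = 0 := by rw [hq, map_mul, hcy, zero_mul]
  simp only [g, map_add, map_sub, map_pow, aeval_X, map_one, ha] at hgL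
  apply (algebraMap K L).injective
  simpa using hgL
end

section
/- Let K be a field containing a primitive third root of unity ξ. Define the linear forms in K[x,y,z]: r_1 = x, r_2 = y, r_3 = z; w_1 = x+y+z, w_2 = x+ξy+ξ²z, w_3 = x+ξ²y+ξz; t_1 = ξx+y+z, t_2 = x+ξy+z, t_3 = x+y+ξz; s_1 = ξ²x+y+z, s_2 = x+ξ²y+z, s_3 = x+y+ξ²z. Then the polynomial identities t_1t_2t_3 = 3(2ξ+1)·r_1r_2r_3 + ξ·w_1w_2w_3 and s_1s_2s_3 = −3(2ξ+1)·r_1r_2r_3 + ξ²·w_1w_2w_3 hold in K[x,y,z]. -/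
open MvPolynomial

/-- The defining identities of the classical 4-net of order 3: if `ξ` is a primitive
third root of unity in `K` then, with `x = X 0`, `y = X 1`, `z = X 2`,
`t₁t₂t₃ = 3(2ξ+1)·r₁r₂r₃ + ξ·w₁w₂w₃` and `s₁s₂s₃ = -3(2ξ+1)·r₁r₂r₃ + ξ²·w₁w₂w₃`. -/
theorem classical_four_net_identities {K : Type*} [Field K]
    (ξ : K) (hξ1 : ξ ≠ 1) (hξ3 : ξ ^ 3 = 1) :
    letI x : MvPolynomial (Fin 3) K := X 0
    letI y : MvPolynomial (Fin 3) K := X 1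
    letI z : MvPolynomial (Fin 3) K := X 2
    ((C ξ * x + y + z) * (x + C ξ * y + z) * (x + y + C ξ * z) =
        C (3 * (2 * ξ + 1)) * (x * y * z) +
          C ξ * ((x + y + z) * (x + C ξ * y + C (ξ ^ 2) * z) *
            (x + C (ξ ^ 2) * y + C ξ * z))) ∧
    ((C (ξ ^ 2) * x + y + z) * (x + C (ξ ^ 2) * y + z) * (x + y + C (ξ ^ 2) * z) =
        C (-(3 * (2 * ξ + 1))) * (x * y * z) +
          C (ξ ^ 2) * ((x + y + z) * (x + C ξ * y + C (ξ ^ 2) * z) *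
            (x + C (ξ ^ 2) * y + C ξ * z))) := by
  have h : ξ ^ 2 + ξ + 1 = 0 := by
    have h1 : (ξ - 1) * (ξ ^ 2 + ξ + 1) = 0 := by linear_combination hξ3
    exact (mul_eq_zero.mp h1).resolve_left (sub_ne_zero.mpr hξ1)
  have hC : (C ξ : MvPolynomial (Fin 3) K) ^ 2 + C ξ + 1 = 0 := by
    rw [← C_pow, ← C_add, ← C_1, ← C_add, h, C_0]
  have h3 : (C (3 * (2 * ξ + 1)) : MvPolynomial (Fin 3) K) = 3 * (2 * C ξ + 1) := by
    simp only [map_mul, map_add, map_one, map_ofNat]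
  simp only [C_neg, h3, C_pow]
  generalize (C ξ : MvPolynomial (Fin 3) K) = w at hC
  generalize (X 0 : MvPolynomial (Fin 3) K) = x
  generalize (X 1 : MvPolynomial (Fin 3) K) = y
  generalize (X 2 : MvPolynomial (Fin 3) K) = z
  constructor <;> grind
end
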